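/- arXiv:1804.09485 — 2 statements merged into one kernel-verified Lean document; each statement's English description precedes it below -/
import Mathlib

section
/- For any prime p ≥ 5, the double sum over i and j from 0 to p-1 of (i+j)*S(i,j) is congruent to -8/3 * (p/3) modulo p (where 1/3 denotes the inverse of 3 mod p). -/
open Finset

/-- The super Catalan numbers `S(m,n) = C(2m,m)·C(2n,n)/C(m+n,m)` (the division is exact). -/
def superCatalan (m n : ℕ) : ℕ :=
  (Nat.choose (2 * m) m * Nat.choose (2 * n) n) / Nat.choose (m + n) m

/-- The recurrence satisfied by the super Catalan numbers, for the defining fractions. -/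
theorem super_catalan_recurrence_rat (m n : ℕ) :
    ((m + 1).centralBinom * n.centralBinom / (m + 1 + n).choose (m + 1) : ℚ) =
      4 * (m.centralBinom * n.centralBinom / (m + n).choose m) -
        m.centralBinom * (n + 1).centralBinom / (m + (n + 1)).choose m := by
  have hm : ((m + 1).centralBinom : ℚ) = 2 * (2 * m + 1) * m.centralBinom / (m + 1) := by
    rw [eq_div_iff (by positivity), mul_comm]
    exact_mod_cast Nat.succ_mul_centralBinom_succ m
  have hn : ((n + 1).centralBinom : ℚ) = 2 * (2 * n + 1) * n.centralBinom / (n + 1) := by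
    rw [eq_div_iff (by positivity), mul_comm]
    exact_mod_cast Nat.succ_mul_centralBinom_succ n
  have hc : ((m + n).choose m : ℚ) ≠ 0 := by
    exact_mod_cast (Nat.choose_pos (by omega)).ne'
  have h1 : ((m + 1 + n).choose (m + 1) : ℚ) = (m + n + 1) * (m + n).choose m / (m + 1) := by
    rw [eq_div_iff (by positivity)]
    have := Nat.add_one_mul_choose_eq (m + n) m
    rw [show m + 1 + n = m + n + 1 by ring]
    exact_mod_cast this.symm
  have h2 : ((m + (n + 1)).choose m : ℚ) = (m + n + 1) * (m + n).choose m / (n + 1) := by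
    rw [eq_div_iff (by positivity)]
    have := Nat.add_one_mul_choose_eq (m + n) n
    rw [show m + (n + 1) = m + n + 1 by ring,
      Nat.choose_symm_of_eq_add (show m + n + 1 = m + (n + 1) by ring),
      Nat.choose_symm_of_eq_add (show m + n = m + n from rfl)]
    exact_mod_cast this.symm
  have hs : (m + n + 1 : ℚ) ≠ 0 := by positivity
  rw [hm, hn, h1, h2]
  field_simp
  ring

theorem exists_int_eq_super_catalan (m n : ℕ) :
    ∃ z : ℤ, (z : ℚ) = m.centralBinom * n.centralBinom / (m + n).choose m := by
  induction m generalizing n with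
  | zero => exact ⟨n.centralBinom, by simp⟩
  | succ m ih =>
    obtain ⟨a, ha⟩ := ih n
    obtain ⟨b, hb⟩ := ih (n + 1)
    exact ⟨4 * a - b, by rw [super_catalan_recurrence_rat, ← ha, ← hb]; push_cast; ring⟩

theorem choose_dvd_centralBinom_mul (m n : ℕ) :
    (m + n).choose m ∣ m.centralBinom * n.centralBinom := by
  obtain ⟨z, hz⟩ := exists_int_eq_super_catalan m n
  have hc : ((m + n).choose m : ℚ) ≠ 0 := by
    exact_mod_cast (Nat.choose_pos (by omega)).ne'
  rw [eq_div_iff hc] at hz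
  have h : z * ((m + n).choose m : ℤ) = m.centralBinom * n.centralBinom := by exact_mod_cast hz
  exact Int.natCast_dvd_natCast.mp ⟨z, by push_cast; rw [← h, mul_comm]⟩

theorem superCatalan_mul_choose (m n : ℕ) :
    superCatalan m n * (m + n).choose m = m.centralBinom * n.centralBinom :=
  Nat.div_mul_cancel (choose_dvd_centralBinom_mul m n)

theorem cast_superCatalan_rat (m n : ℕ) :
    (superCatalan m n : ℚ) = m.centralBinom * n.centralBinom / (m + n).choose m := by
  rw [eq_div_iff (by exact_mod_cast (Nat.choose_pos (by omega)).ne')]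
  exact_mod_cast superCatalan_mul_choose m n

theorem superCatalan_recurrence (m n : ℕ) :
    superCatalan (m + 1) n + superCatalan m (n + 1) = 4 * superCatalan m n := by
  have h := super_catalan_recurrence_rat m n
  rw [← cast_superCatalan_rat, ← cast_superCatalan_rat, ← cast_superCatalan_rat] at h
  have : (superCatalan (m + 1) n + superCatalan m (n + 1) : ℚ) = 4 * superCatalan m n := by
    rw [h]; ring
  exact_mod_cast this

theorem superCatalan_comm (m n : ℕ) : superCatalan m n = superCatalan n m := by
  unfold superCatalan
  rw [mul_comm, Nat.choose_symm_add, add_comm m n]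

theorem superCatalan_zero_left (n : ℕ) : superCatalan 0 n = n.centralBinom := by
  simp [superCatalan, Nat.centralBinom]

section ModP

variable {p : ℕ} [Fact p.Prime]

theorem cast_superCatalan_prime_left (hp2 : 2 < p) {n : ℕ} (hn : n < p) :
    (superCatalan p n : ZMod p) = 2 * n.centralBinom := by
  have hp : 0 < p := by omega
  have h := congrArg (Nat.cast (R := ZMod p)) (superCatalan_mul_choose p n)
  have h1 : ((p + n).choose p : ZMod p) = 1 := by
    have := (ZMod.natCast_eq_natCast_iff _ _ _).2
      (Choose.choose_modEq_choose_mod_mul_choose_div_nat (n := p + n) (k := p) (p := p))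
    simpa [Nat.add_div_left n hp, Nat.div_eq_of_lt hn, Nat.div_self hp] using this
  have h2 : (p.centralBinom : ZMod p) = 2 := by
    have := (ZMod.natCast_eq_natCast_iff _ _ _).2
      (Choose.choose_modEq_choose_mod_mul_choose_div_nat (n := 2 * p) (k := p) (p := p))
    simpa [Nat.centralBinom, Nat.mul_div_cancel _ hp, Nat.div_self hp] using this
  push_cast at h
  rwa [h1, h2, mul_one] at h

theorem cast_centralBinom_eq_choose_half (hp2 : 2 < p) {j : ℕ} (hj : j < p) :
    (j.centralBinom : ZMod p) = (p / 2).choose j * (-4) ^ j := by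
  have hodd : (2 * (p / 2 : ℕ) + 1 : ZMod p) = 0 := by
    have h : 2 * (p / 2) + 1 = p :=
      Nat.two_mul_div_two_add_one_of_odd ((Fact.out : p.Prime).odd_of_ne_two (by omega))
    have := congrArg (Nat.cast (R := ZMod p)) h
    push_cast at this
    rwa [CharP.cast_eq_zero (ZMod p) p] at this
  induction j with
  | zero => simp
  | succ j ih =>
    have hne : ((j : ZMod p) + 1) ≠ 0 := by
      have : ((j + 1 : ℕ) : ZMod p) ≠ 0 := by
        rw [Ne, ZMod.natCast_eq_zero_iff]
        exact Nat.not_dvd_of_pos_of_lt (by omega) hj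
      exact_mod_cast this
    have h1 := congrArg (Nat.cast (R := ZMod p)) (Nat.succ_mul_centralBinom_succ j)
    have h2 : ((p / 2).choose (j + 1) * (j + 1) : ZMod p) =
        (p / 2).choose j * ((p / 2 : ℕ) - j) := by
      have h := congrArg (Nat.cast (R := ZMod p)) (Nat.choose_succ_right_eq (p / 2) j)
      rcases le_or_gt j (p / 2) with hle | hlt
      · push_cast [Nat.cast_sub hle] at h
        exact h
      · simp [Nat.choose_eq_zero_of_lt hlt, Nat.choose_eq_zero_of_lt (hlt.trans (Nat.lt_succ_self j))]
    push_cast at h1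
    rw [ih (by omega)] at h1
    apply mul_left_cancel₀ hne
    rw [h1, pow_succ]
    linear_combination (4 * (-4) ^ j) * h2 + 2 * (p / 2).choose j * (-4) ^ j * hodd

theorem sum_centralBinom_eq (hp2 : 2 < p) :
    ∑ j ∈ range p, (j.centralBinom : ZMod p) = (-3) ^ (p / 2) := by
  rw [sum_congr rfl fun j hj => cast_centralBinom_eq_choose_half hp2 (mem_range.1 hj),
    ← sum_subset (range_subset_range.2 (show p / 2 + 1 ≤ p by omega)),
    show (-3 : ZMod p) = -4 + 1 by norm_num, add_pow]
  · exact sum_congr rfl fun j _ => by ring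
  · intro j _ hj
    rw [Nat.choose_eq_zero_of_lt (by simpa [Nat.lt_succ_iff] using hj)]
    simp

theorem sum_mul_centralBinom_eq (hp2 : 3 < p) :
    ∑ j ∈ range p, (j * j.centralBinom : ZMod p) = -(2 * 3⁻¹) * (-3) ^ (p / 2) := by
  obtain ⟨k, hk⟩ : ∃ k, p / 2 = k + 1 := ⟨p / 2 - 1, by omega⟩
  have hodd : (2 * (k + 1) + 1 : ZMod p) = 0 := by
    have h : 2 * (p / 2) + 1 = p :=
      Nat.two_mul_div_two_add_one_of_odd ((Fact.out : p.Prime).odd_of_ne_two (by omega))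
    have := congrArg (Nat.cast (R := ZMod p)) h
    push_cast at this
    rw [hk, CharP.cast_eq_zero (ZMod p) p] at this
    exact_mod_cast this
  have h3 : (3 : ZMod p) ≠ 0 := by
    have : ((3 : ℕ) : ZMod p) ≠ 0 := by
      rw [Ne, ZMod.natCast_eq_zero_iff]
      exact Nat.not_dvd_of_pos_of_lt (by omega) hp2
    exact_mod_cast this
  have key : ∑ j ∈ range p, (j * j.centralBinom : ZMod p) = (k + 1) * (-4) * (-3) ^ k := by
    rw [sum_congr rfl fun j hj => by
        rw [cast_centralBinom_eq_choose_half (by omega) (mem_range.1 hj)],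
      ← sum_subset (range_subset_range.2 (show p / 2 + 1 ≤ p by omega)), hk, sum_range_succ',
      show (-3 : ZMod p) = -4 + 1 by norm_num, add_pow, mul_sum]
    · simp only [Nat.cast_zero, zero_mul, add_zero]
      refine sum_congr rfl fun j _ => ?_
      have := congrArg (Nat.cast (R := ZMod p)) (Nat.add_one_mul_choose_eq k j)
      push_cast at this ⊢
      linear_combination -(-4) ^ (j + 1) * this
    · intro j _ hj
      rw [Nat.choose_eq_zero_of_lt (by simpa [Nat.lt_succ_iff] using hj)]
      simp
  rw [key, hk, pow_succ]
  field_simp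
  linear_combination (-2) * (-3) ^ k * hodd

theorem cast_legendreSym_three (hp3 : 3 < p) :
    (legendreSym 3 p : ZMod p) = (-3) ^ (p / 2) := by
  rw [legendreSym.quadratic_reciprocity' (p := p) (q := 3) (by omega) (by omega)]
  push_cast
  have := legendreSym.eq_pow p 3
  push_cast at this
  rw [this, neg_pow (3 : ZMod p)]
  norm_num

theorem sum_range_sum_range_succ_left {M : Type*} [AddCommGroup M] (f : ℕ → ℕ → M) (n : ℕ) :
    ∑ i ∈ range n, ∑ j ∈ range n, f (i + 1) j =
      ∑ i ∈ range n, ∑ j ∈ range n, f i j + ∑ j ∈ range n, f n j - ∑ j ∈ range n, f 0 j := by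
  rw [eq_sub_iff_add_eq, ← sum_range_succ' (fun i => ∑ j ∈ range n, f i j), sum_range_succ]

theorem sum_sum_succ_superCatalan (hp2 : 2 < p) (w : ZMod p → ZMod p) :
    ∑ i ∈ range p, ∑ j ∈ range p, w (i + 1 + j) * superCatalan (i + 1) j =
      ∑ i ∈ range p, ∑ j ∈ range p, w (i + j) * superCatalan i j +
        ∑ j ∈ range p, w j * j.centralBinom := by
  have h := sum_range_sum_range_succ_left
    (fun i j => w ((i : ZMod p) + j) * (superCatalan i j : ZMod p)) p
  push_cast at h
  have hp : ∑ j ∈ range p, w (p + j) * (superCatalan p j : ZMod p) =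
      2 * ∑ j ∈ range p, w j * j.centralBinom := by
    rw [mul_sum]
    refine sum_congr rfl fun j hj => ?_
    rw [cast_superCatalan_prime_left hp2 (mem_range.1 hj), CharP.cast_eq_zero, zero_add]
    ring
  rw [h, hp]
  simp only [superCatalan_zero_left, zero_add]
  ring

theorem four_mul_sum_sum_superCatalan (w : ZMod p → ZMod p) :
    4 * ∑ i ∈ range p, ∑ j ∈ range p, w (i + j) * superCatalan i j =
      2 * ∑ i ∈ range p, ∑ j ∈ range p, w (i + j) * superCatalan (i + 1) j := by
  have hsymm : ∑ i ∈ range p, ∑ j ∈ range p, w (i + j) * (superCatalan i (j + 1) : ZMod p) =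
      ∑ i ∈ range p, ∑ j ∈ range p, w (i + j) * superCatalan (i + 1) j := by
    rw [sum_comm]
    refine sum_congr rfl fun i _ => sum_congr rfl fun j _ => ?_
    rw [superCatalan_comm, add_comm (i : ZMod p)]
  rw [two_mul]
  nth_rw 2 [← hsymm]
  simp only [mul_sum, ← sum_add_distrib]
  refine sum_congr rfl fun i _ => sum_congr rfl fun j _ => ?_
  have := congrArg (Nat.cast (R := ZMod p)) (superCatalan_recurrence i j)
  push_cast at this
  linear_combination -w (i + j) * this

end ModP

theorem stmt2 (p : ℕ) (hp : p.Prime) (hp5 : 5 ≤ p) :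
    (↑(∑ i ∈ Finset.range p, ∑ j ∈ Finset.range p, (i + j) * superCatalan i j) : ZMod p) =
      -(8 * (3 : ZMod p)⁻¹) * (legendreSym 3 p : ZMod p) := by
  have : Fact p.Prime := ⟨hp⟩
  have h2 : (2 : ZMod p) ≠ 0 := by
    have : ((2 : ℕ) : ZMod p) ≠ 0 := by
      rw [Ne, ZMod.natCast_eq_zero_iff]
      exact Nat.not_dvd_of_pos_of_lt (by omega) (by omega)
    exact_mod_cast this
  have h3 : (3 : ZMod p) ≠ 0 := by
    have : ((3 : ℕ) : ZMod p) ≠ 0 := by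
      rw [Ne, ZMod.natCast_eq_zero_iff]
      exact Nat.not_dvd_of_pos_of_lt (by omega) (by omega)
    exact_mod_cast this
  have hT := four_mul_sum_sum_superCatalan (p := p) fun _ => 1
  have hT' := sum_sum_succ_superCatalan (p := p) (by omega) fun _ => 1
  have hU := four_mul_sum_sum_superCatalan (p := p) fun x => x
  have hU' := sum_sum_succ_superCatalan (p := p) (by omega) fun x => x
  simp only [one_mul] at hT hT'
  have hsplit : ∑ i ∈ range p, ∑ j ∈ range p, ((i : ZMod p) + 1 + j) * superCatalan (i + 1) j =
      ∑ i ∈ range p, ∑ j ∈ range p, ((i : ZMod p) + j) * superCatalan (i + 1) j +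
        ∑ i ∈ range p, ∑ j ∈ range p, (superCatalan (i + 1) j : ZMod p) := by
    simp only [← sum_add_distrib]
    exact sum_congr rfl fun i _ => sum_congr rfl fun j _ => by ring
  rw [sum_centralBinom_eq (by omega)] at hT'
  rw [sum_mul_centralBinom_eq (by omega)] at hU'
  rw [cast_legendreSym_three (by omega)]
  push_cast
  field_simp at hU' ⊢
  apply mul_left_cancel₀ h2
  linear_combination 3 * hU + 2 * hU' - 6 * hsplit - 3 * hT - 12 * hT'
end

section
/- For any prime p ≥ 5, sum over k from 0 to p-1 of C(2k,k) is congruent to the Legendre symbol (p/3) modulo p^2. -/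
open Finset

theorem quadraticChar_zmod_three_add (a : ZMod 3) :
    quadraticChar (ZMod 3) (a + 1) + quadraticChar (ZMod 3) a +
      quadraticChar (ZMod 3) (a - 1) = 0 := by
  revert a; decide

theorem quadraticChar_zmod_three_neg (a : ZMod 3) :
    quadraticChar (ZMod 3) (-a) = -quadraticChar (ZMod 3) a := by
  revert a; decide

/-- The partial binomial sum `∑ k < N, C(m, k) * χ (a - k)`,
where `χ` is the quadratic character modulo 3. -/
def chooseCharSum (m : ℕ) (a : ZMod 3) (N : ℕ) : ℤ :=
  ∑ k ∈ range N, (m.choose k : ℤ) * quadraticChar (ZMod 3) (a - k)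

theorem chooseCharSum_succ_right (m : ℕ) (a : ZMod 3) (N : ℕ) :
    chooseCharSum m a (N + 1) =
      chooseCharSum m a N + m.choose N * quadraticChar (ZMod 3) (a - N) :=
  sum_range_succ _ _

theorem chooseCharSum_succ_left (m : ℕ) (a : ZMod 3) (N : ℕ) :
    chooseCharSum (m + 1) a (N + 1) =
      chooseCharSum m a (N + 1) + chooseCharSum m (a - 1) N := by
  induction N with
  | zero => simp [chooseCharSum]
  | succ N ih =>
    rw [chooseCharSum_succ_right (m + 1), ih, chooseCharSum_succ_right m a (N + 1),
      chooseCharSum_succ_right m (a - 1) N, Nat.choose_succ_succ,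
      show a - 1 - (N : ZMod 3) = a - ((N + 1 : ℕ) : ZMod 3) by push_cast; ring]
    push_cast
    ring

theorem chooseCharSum_add (m : ℕ) (a : ZMod 3) (N : ℕ) :
    chooseCharSum m (a + 1) N + chooseCharSum m a N + chooseCharSum m (a - 1) N = 0 := by
  simp only [chooseCharSum, ← sum_add_distrib, ← mul_add]
  refine sum_eq_zero fun k _ => ?_
  rw [add_sub_right_comm, sub_right_comm a 1, quadraticChar_zmod_three_add, mul_zero]

theorem chooseCharSum_full (m : ℕ) (a : ZMod 3) :
    chooseCharSum m a (m + 1) = (-1) ^ m * quadraticChar (ZMod 3) (a + m) := by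
  induction m generalizing a with
  | zero => simp [chooseCharSum]
  | succ m ih =>
    have h := chooseCharSum_add m a (m + 1)
    rw [chooseCharSum_succ_left, chooseCharSum_succ_right m a (m + 1), Nat.choose_succ_self]
    rw [ih (a + 1)] at h
    rw [show a + ((m + 1 : ℕ) : ZMod 3) = a + 1 + m by push_cast; ring]
    push_cast
    linear_combination h

theorem sum_centralBinom_eq_chooseCharSum (n : ℕ) :
    ∑ k ∈ range n, ((2 * k).choose k : ℤ) = chooseCharSum (2 * n) n n := by
  induction n with
  | zero => simp [chooseCharSum]
  | succ n ih =>
    rw [sum_range_succ, ih]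
    rcases n with _ | n
    · simp [chooseCharSum]
    · have h := chooseCharSum_add (2 * (n + 1)) ((n + 1 : ℕ) : ZMod 3) (n + 1)
      have h1 := chooseCharSum_succ_right (2 * (n + 1)) (((n + 1 : ℕ) : ZMod 3) + 1) (n + 1)
      have h2 := chooseCharSum_succ_right (2 * (n + 1)) (((n + 1 : ℕ) : ZMod 3) - 1) n
      rw [add_sub_cancel_left, map_one, mul_one] at h1
      rw [show ((n + 1 : ℕ) : ZMod 3) - 1 - n = 0 by push_cast; ring,
        MulChar.map_zero, mul_zero, add_zero] at h2
      rw [show 2 * (n + 1 + 1) = 2 * (n + 1) + 1 + 1 by ring, chooseCharSum_succ_left,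
        chooseCharSum_succ_left, Nat.cast_succ (n + 1), add_sub_cancel_right,
        chooseCharSum_succ_left]
      linear_combination -h - h1 + h2

theorem Nat.Prime.sq_dvd_choose_two_mul_sub {p k : ℕ} (hp : p.Prime) (hk : k ≠ 0) (hkp : k < p) :
    (p : ℤ) ^ 2 ∣ (2 * p).choose k - 2 * p.choose k := by
  obtain ⟨k, rfl⟩ := Nat.exists_eq_succ_of_ne_zero hk
  rw [two_mul, Nat.add_choose_eq, Finset.Nat.sum_antidiagonal_eq_sum_range_succ_mk,
    sum_range_succ, sum_range_succ']
  push_cast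
  simp only [Nat.succ_eq_add_one, Nat.sub_self, Nat.choose_zero_right, Nat.cast_one,
    one_mul, mul_one]
  rw [show ∀ s c : ℤ, s + c + c - 2 * c = s by intros; ring]
  refine dvd_sum fun i hi => ?_
  rw [mem_range] at hi
  rw [sq]
  exact mul_dvd_mul
    (Int.natCast_dvd_natCast.2 (hp.dvd_choose_self (by omega) (by omega)))
    (Int.natCast_dvd_natCast.2 (hp.dvd_choose_self (by omega) (by omega)))

theorem chooseCharSum_self {p : ℕ} (hp : Odd p) :
    chooseCharSum p p p = quadraticChar (ZMod 3) p := by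
  have h := chooseCharSum_full p p
  rw [chooseCharSum_succ_right, sub_self, MulChar.map_zero, mul_zero, add_zero, hp.neg_one_pow,
    show (p : ZMod 3) + p = -p by
      linear_combination (p : ZMod 3) * (by decide : (3 : ZMod 3) = 0),
    quadraticChar_zmod_three_neg] at h
  linear_combination h

theorem stmt7 (p : ℕ) (hp : p.Prime) (hp5 : 5 ≤ p) :
    (↑(∑ k ∈ Finset.range p, Nat.choose (2 * k) k) : ZMod (p ^ 2)) =
      (legendreSym 3 p : ZMod (p ^ 2)) := by
  have hodd : Odd p := hp.odd_of_ne_two (by omega)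
  have hL : legendreSym 3 p = quadraticChar (ZMod 3) p := by simp [legendreSym]
  have key : ((p ^ 2 : ℕ) : ℤ) ∣
      (∑ k ∈ range p, ((2 * k).choose k : ℤ)) - legendreSym 3 p := by
    have hsum : (∑ k ∈ range p, ((2 * k).choose k : ℤ)) - legendreSym 3 p =
        ∑ k ∈ (range p).erase 0, (((2 * p).choose k : ℤ) - 2 * p.choose k) *
          quadraticChar (ZMod 3) (p - k) := by
      have h0 := sum_erase_add (range p)
        (fun k : ℕ => (((2 * p).choose k : ℤ) - 2 * p.choose k) *
          quadraticChar (ZMod 3) (p - k)) (mem_range.2 hp.pos)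
      have h1 := chooseCharSum_self hodd
      rw [sum_centralBinom_eq_chooseCharSum, hL]
      simp only [sub_mul, sum_sub_distrib, mul_assoc, ← mul_sum, Nat.choose_zero_right,
        Nat.cast_zero, sub_zero, Nat.cast_one, one_mul] at h0 ⊢
      simp only [chooseCharSum] at h1 ⊢
      linear_combination -h0 + 2 * h1
    rw [hsum]
    refine dvd_sum fun k hk => Dvd.dvd.mul_right ?_ _
    rw [mem_erase, mem_range] at hk
    exact_mod_cast hp.sq_dvd_choose_two_mul_sub hk.1 hk.2
  have h := (ZMod.intCast_eq_intCast_iff_dvd_sub _ _ _).2 key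
  rw [h]
  push_cast
  rfl
end
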